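/- For k \geq 1 and 0 < p < 1, 0 < q < 1, the expected length of a Best-of-(2k+1) game is strictly greater under the Catch-Up Rule than under the Standard Rule if and only if p + q > 1 (with equality of expected lengths iff p + q = 1). -/

import Mathlib

/-- Expected number of points remaining in a service game played to `goal` points.
`next prevSrv aWon` gives the next server (`true` = A serves). `srv = true` means
A serves the current point; A wins on his serve with probability `p`, B wins on her
serve with probability `q`. `fuel` bounds the number of points played. -/
def expLen (p q : ℝ) (goal : ℕ) (next : Bool → Bool → Bool) :
    ℕ → ℕ → ℕ → Bool → ℝ
  | 0, _, _, _ => 0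
  | fuel + 1, x, y, srv =>
    if goal ≤ x ∨ goal ≤ y then 0
    else
      1 + (if srv then p else 1 - q) * expLen p q goal next fuel (x + 1) y (next srv true) +
        (1 - if srv then p else 1 - q) * expLen p q goal next fuel x (y + 1) (next srv false)

/-- Standard Rule: the winner of the point serves next. -/
def nextSR : Bool → Bool → Bool := fun _ aWon => aWon

/-- Catch-Up Rule: the loser of the point serves next. -/
def nextCR : Bool → Bool → Bool := fun _ aWon => !aWon

/-- Expected value of `f` at A's final score when he has `x` points, `a` points on A's serve and
`b` points on B's serve remain, A winning these with probability `p`, resp. `r`. -/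
noncomputable def fullVal (p r : ℝ) (f : ℕ → ℝ) : ℕ → ℕ → ℕ → ℝ
  | 0, 0, x => f x
  | 0, b + 1, x => r * fullVal p r f 0 b (x + 1) + (1 - r) * fullVal p r f 0 b x
  | a + 1, b, x => p * fullVal p r f a b (x + 1) + (1 - p) * fullVal p r f a b x

theorem fullVal_A (p r : ℝ) (f : ℕ → ℝ) (a b x : ℕ) :
    fullVal p r f (a + 1) b x
      = p * fullVal p r f a b (x + 1) + (1 - p) * fullVal p r f a b x := by
  rw [fullVal]

theorem fullVal_B (p r : ℝ) (f : ℕ → ℝ) (a b x : ℕ) :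
    fullVal p r f a (b + 1) x
      = r * fullVal p r f a b (x + 1) + (1 - r) * fullVal p r f a b x := by
  induction a generalizing x with
  | zero => rw [fullVal]
  | succ a ih => simp only [fullVal_A, ih]; ring

/-- Overshoot of A over `g` points. -/
def overA (g z : ℕ) : ℝ := ((z - g : ℕ) : ℝ)

/-- Overshoot of B over `g` points out of `2 g - 1`. -/
def overB (g z : ℕ) : ℝ := ((g - 1 - z : ℕ) : ℝ)

theorem fullVal_affine (p r c : ℝ) (s : ℝ) (f : ℕ → ℝ) (a b x : ℕ)
    (h : ∀ z, x ≤ z → z ≤ x + a + b → f z = c + s * z) :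
    fullVal p r f a b x = c + s * (x + p * a + r * b) := by
  induction a generalizing x with
  | zero =>
    induction b generalizing x with
    | zero => rw [fullVal, h x le_rfl (by omega)]; simp
    | succ b ih =>
      rw [fullVal_B, ih (x + 1) (fun z h1 h2 => h z (by omega) (by omega)),
        ih x (fun z h1 h2 => h z (by omega) (by omega))]
      push_cast; ring
  | succ a ih =>
    rw [fullVal_A, ih (x + 1) (fun z h1 h2 => h z (by omega) (by omega)),
      ih x (fun z h1 h2 => h z (by omega) (by omega))]
    push_cast; ring

theorem fullVal_overA_ge (p r : ℝ) (g a b : ℕ) :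
    fullVal p r (overA g) a b g = p * a + r * b := by
  rw [fullVal_affine p r (-g) 1]
  · ring
  · intro z h1 _
    rw [overA, Nat.cast_sub h1]; ring

theorem fullVal_overA_le (p r : ℝ) (g a b x : ℕ) (h : x + a + b ≤ g) :
    fullVal p r (overA g) a b x = 0 := by
  rw [fullVal_affine p r 0 0]
  · ring
  · intro z _ h2
    rw [overA, Nat.sub_eq_zero_of_le (by omega)]; simp

theorem fullVal_overB_ge (p r : ℝ) (g a b : ℕ) :
    fullVal p r (overB g) a b g = 0 := by
  rw [fullVal_affine p r 0 0]
  · ring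
  · intro z _ h2
    rw [overB, Nat.sub_eq_zero_of_le (by omega)]; simp

theorem fullVal_overB_le (p r : ℝ) (g a b x : ℕ) (h : x + a + b + 1 = g) :
    fullVal p r (overB g) a b x = (1 - p) * a + (1 - r) * b := by
  subst h
  rw [fullVal_affine p r (x + a + b) (-1)]
  · ring
  · intro z _ h2
    rw [overB, Nat.add_sub_cancel, Nat.cast_sub h2]; push_cast; ring

theorem fullVal_nonneg (p r : ℝ) (f : ℕ → ℝ) (hf : ∀ z, 0 ≤ f z) (hp0 : 0 < p) (hp1 : p < 1)
    (hr0 : 0 < r) (hr1 : r < 1) (a b x : ℕ) : 0 ≤ fullVal p r f a b x := by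
  have h1 : 0 < 1 - p := by linarith
  have h2 : 0 < 1 - r := by linarith
  induction a generalizing x with
  | zero =>
    induction b generalizing x with
    | zero => rw [fullVal]; exact hf x
    | succ b ih =>
      rw [fullVal_B]
      have := ih (x + 1)
      have := ih x
      positivity
  | succ a ih =>
    rw [fullVal_A]
    have := ih (x + 1)
    have := ih x
    positivity

theorem fullVal_pos (p r : ℝ) (f : ℕ → ℝ) (hf : ∀ z, 0 ≤ f z) (hp0 : 0 < p) (hp1 : p < 1)
    (hr0 : 0 < r) (hr1 : r < 1) (a b x : ℕ) (h : 0 < f (x + a + b)) :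
    0 < fullVal p r f a b x := by
  have h1 : 0 < 1 - p := by linarith
  have h2 : 0 < 1 - r := by linarith
  have hn := fullVal_nonneg p r f hf hp0 hp1 hr0 hr1
  induction a generalizing x with
  | zero =>
    induction b generalizing x with
    | zero => rw [fullVal]; exact h
    | succ b ih =>
      rw [fullVal_B]
      have := ih (x + 1) (by convert h using 2; omega)
      have := hn 0 b x
      positivity
  | succ a ih =>
    rw [fullVal_A]
    have := ih (x + 1) (by convert h using 2; omega)
    have := hn a b x
    positivity

/-- Under the Standard Rule the expected number of unplayed points is
`O_A / r + O_B / (1 - p)`. -/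
theorem expLen_SR (p q : ℝ) (hp1 : p < 1) (hq1 : q < 1) (g fuel : ℕ) :
    (∀ a b x y : ℕ, x + a = g → y + b + 1 = g → a + b + 1 ≤ fuel →
      expLen p q g nextSR fuel x y true = a + b
        - (fullVal p (1 - q) (overA g) a b x / (1 - q)
          + fullVal p (1 - q) (overB g) a b x / (1 - p))) ∧
    (∀ a b x y : ℕ, x + a + 1 = g → y + b = g → a + b + 1 ≤ fuel →
      expLen p q g nextSR fuel x y false = a + b
        - (fullVal p (1 - q) (overA g) a b x / (1 - q)
          + fullVal p (1 - q) (overB g) a b x / (1 - p))) := by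
  have h1 : 1 - p ≠ 0 := by linarith
  have h2 : 1 - q ≠ 0 := by linarith
  induction fuel with
  | zero => exact ⟨fun _ _ _ _ _ _ h => by omega, fun _ _ _ _ _ _ h => by omega⟩
  | succ n ih =>
    obtain ⟨iht, ihf⟩ := ih
    constructor
    · intro a b x y hx hy hn
      cases a with
      | zero =>
        obtain rfl : x = g := by omega
        rw [expLen, if_pos (Or.inl le_rfl), fullVal_overA_ge, fullVal_overB_ge]
        field_simp; push_cast; ring
      | succ a =>
        rw [expLen, if_neg (by omega)]
        simp only [nextSR, if_true]
        rw [iht a b (x + 1) y (by omega) hy (by omega),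
          ihf a b x (y + 1) (by omega) (by omega) (by omega), fullVal_A, fullVal_A]
        push_cast; ring
    · intro a b x y hx hy hn
      cases b with
      | zero =>
        obtain rfl : y = g := by omega
        rw [expLen, if_pos (Or.inr le_rfl), fullVal_overA_le _ _ _ _ _ _ (by omega),
          fullVal_overB_le _ _ _ _ _ _ (by omega)]
        field_simp; push_cast; ring
      | succ b =>
        rw [expLen, if_neg (by omega)]
        simp only [nextSR, Bool.false_eq_true, if_false]
        rw [iht a b (x + 1) y (by omega) (by omega) (by omega),
          ihf a b x (y + 1) (by omega) (by omega) (by omega), fullVal_B, fullVal_B]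
        push_cast; ring

/-- Under the Catch-Up Rule the expected number of unplayed points is
`O_A / p + O_B / (1 - r)`, with `1 - r = q`. -/
theorem expLen_CR (p q : ℝ) (hp0 : 0 < p) (hq0 : 0 < q) (g fuel : ℕ) :
    (∀ a b x y : ℕ, y + a = g → x + b + 1 = g → a + b + 1 ≤ fuel →
      expLen p q g nextCR fuel x y true = a + b
        - (fullVal p (1 - q) (overA g) a b x / p
          + fullVal p (1 - q) (overB g) a b x / q)) ∧
    (∀ a b x y : ℕ, y + a + 1 = g → x + b = g → a + b + 1 ≤ fuel →
      expLen p q g nextCR fuel x y false = a + b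
        - (fullVal p (1 - q) (overA g) a b x / p
          + fullVal p (1 - q) (overB g) a b x / q)) := by
  have h1 : p ≠ 0 := by linarith
  have h2 : q ≠ 0 := by linarith
  induction fuel with
  | zero => exact ⟨fun _ _ _ _ _ _ h => by omega, fun _ _ _ _ _ _ h => by omega⟩
  | succ n ih =>
    obtain ⟨iht, ihf⟩ := ih
    constructor
    · intro a b x y hx hy hn
      cases a with
      | zero =>
        obtain rfl : y = g := by omega
        rw [expLen, if_pos (Or.inr le_rfl), fullVal_overA_le _ _ _ _ _ _ (by omega),
          fullVal_overB_le _ _ _ _ _ _ (by omega)]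
        field_simp; push_cast; ring
      | succ a =>
        rw [expLen, if_neg (by omega)]
        simp only [nextCR, if_true, Bool.not_true, Bool.not_false]
        rw [iht a b x (y + 1) (by omega) (by omega) (by omega),
          ihf a b (x + 1) y (by omega) (by omega) (by omega), fullVal_A, fullVal_A]
        push_cast; ring
    · intro a b x y hx hy hn
      cases b with
      | zero =>
        obtain rfl : x = g := by omega
        rw [expLen, if_pos (Or.inl le_rfl), fullVal_overA_ge, fullVal_overB_ge]
        field_simp; push_cast; ring
      | succ b =>
        rw [expLen, if_neg (by omega)]
        simp only [nextCR, Bool.false_eq_true, if_false, Bool.not_true, Bool.not_false]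
        rw [iht a b x (y + 1) (by omega) (by omega) (by omega),
          ihf a b (x + 1) y (by omega) (by omega) (by omega), fullVal_B, fullVal_B]
        push_cast; ring

/-- For `k ≥ 1` and `0 < p < 1`, `0 < q < 1`, the expected length of a Best-of-(2k+1)
game (A serving first) is strictly greater under the Catch-Up Rule than under the
Standard Rule if and only if `p + q > 1`, with equality iff `p + q = 1`. -/
theorem CR_expLen_gt_SR_iff (k : ℕ) (hk : 1 ≤ k) (p q : ℝ)
    (hp0 : 0 < p) (hp1 : p < 1) (hq0 : 0 < q) (hq1 : q < 1) :
    (expLen p q (k + 1) nextCR (2 * k + 2) 0 0 true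
        > expLen p q (k + 1) nextSR (2 * k + 2) 0 0 true ↔ p + q > 1) ∧
      (expLen p q (k + 1) nextCR (2 * k + 2) 0 0 true
        = expLen p q (k + 1) nextSR (2 * k + 2) 0 0 true ↔ p + q = 1) := by
  have hr0 : 0 < 1 - q := by linarith
  have hp' : 0 < 1 - p := by linarith
  have hC := (expLen_CR p q hp0 hq0 (k + 1) (2 * k + 2)).1 (k + 1) k 0 0
    (by omega) (by omega) (by omega)
  have hS := (expLen_SR p q hp1 hq1 (k + 1) (2 * k + 2)).1 (k + 1) k 0 0
    (by omega) (by omega) (by omega)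
  have hA : 0 < fullVal p (1 - q) (overA (k + 1)) (k + 1) k 0 := by
    apply fullVal_pos _ _ _ (fun z => Nat.cast_nonneg _) hp0 hp1 hr0 (by linarith)
    exact_mod_cast (by omega : 0 < 0 + (k + 1) + k - (k + 1))
  have hB : 0 ≤ fullVal p (1 - q) (overB (k + 1)) (k + 1) k 0 :=
    fullVal_nonneg _ _ _ (fun z => Nat.cast_nonneg _) hp0 hp1 hr0 (by linarith) _ _ _
  generalize fullVal p (1 - q) (overA (k + 1)) (k + 1) k 0 = A at *
  generalize fullVal p (1 - q) (overB (k + 1)) (k + 1) k 0 = B at *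
  have hK : 0 < A / (p * (1 - q)) + B / (q * (1 - p)) := by positivity
  have hD : expLen p q (k + 1) nextCR (2 * k + 2) 0 0 true
      - expLen p q (k + 1) nextSR (2 * k + 2) 0 0 true
      = (p + q - 1) * (A / (p * (1 - q)) + B / (q * (1 - p))) := by
    rw [hC, hS]; field_simp; ring
  generalize expLen p q (k + 1) nextCR (2 * k + 2) 0 0 true = X at *
  generalize expLen p q (k + 1) nextSR (2 * k + 2) 0 0 true = Y at *
  constructor
  · rw [gt_iff_lt, gt_iff_lt, ← sub_pos, hD, mul_pos_iff_of_pos_right hK, sub_pos]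
  · rw [← sub_eq_zero, hD, mul_eq_zero, or_iff_left hK.ne', sub_eq_zero]
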